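/- arXiv:1310.3216 — 4 statements merged into one kernel-verified Lean document; each statement's English description precedes it below -/
import Mathlib

section
/- Let G be a finitely generated nilpotent group with finite symmetric generating set and word length |·|_G. Then for any g, h ∈ G one has |gⁿ h g⁻ⁿ|_G = o(n) as n → ∞; that is, |gⁿ h g⁻ⁿ|_G / n → 0 as n → ∞. -/
open Filter

/-- Word length of `g` with respect to a generating set `S`:
the least `n` such that `g` is a product of `n` elements of `S`. -/
noncomputable def wlen {G : Type*} [Group G] (S : Set G) (g : G) : ℕ :=
  sInf {n : ℕ | ∃ l : List G, (∀ s ∈ l, s ∈ S) ∧ l.length = n ∧ l.prod = g}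

open fwdDiff
open scoped commutatorElement

section PolynomialSequences

variable {G : Type*} [Group G]

/-- A descending family of subgroups with `⁅H i, H j⁆ ≤ H (i + j)`. -/
structure IsCommFiltration (H : ℕ → Subgroup G) : Prop where
  anti : Antitone H
  comm : ∀ {i j : ℕ} {x y : G}, x ∈ H i → y ∈ H j → ⁅x, y⁆ ∈ H (i + j)

/-- The multiplicative difference of a sequence in a group. -/
def mulDiff (f : ℕ → G) : ℕ → G := fun n => f (n + 1) * (f n)⁻¹

/-- Sequences whose `l`-th difference takes values in `H (i + l)` for all `l ≤ d`. -/
def PolyUpTo (H : ℕ → Subgroup G) : ℕ → ℕ → (ℕ → G) → Prop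
  | 0, i, f => ∀ n, f n ∈ H i
  | d + 1, i, f => (∀ n, f n ∈ H i) ∧ PolyUpTo H d (i + 1) (mulDiff f)

variable {H : ℕ → Subgroup G}

lemma PolyUpTo.apply_mem {d i : ℕ} {f : ℕ → G} (hf : PolyUpTo H d i f) (n : ℕ) : f n ∈ H i := by
  cases d with
  | zero => exact hf n
  | succ d => exact hf.1 n

lemma PolyUpTo.of_succ {d i : ℕ} {f : ℕ → G} (hf : PolyUpTo H (d + 1) i f) :
    PolyUpTo H d i f := by
  induction d generalizing i f with
  | zero => exact hf.1
  | succ d ih => exact ⟨hf.1, ih hf.2⟩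

lemma PolyUpTo.mono (hH : Antitone H) {d i j : ℕ} (hij : i ≤ j) {f : ℕ → G}
    (hf : PolyUpTo H d j f) : PolyUpTo H d i f := by
  induction d generalizing i j f with
  | zero => exact fun n => hH hij (hf n)
  | succ d ih => exact ⟨fun n => hH hij (hf.1 n), ih (Nat.succ_le_succ hij) hf.2⟩

lemma PolyUpTo.one (d i : ℕ) : PolyUpTo H d i (1 : ℕ → G) := by
  induction d generalizing i with
  | zero => exact fun n => one_mem _
  | succ d ih =>
    refine ⟨fun n => one_mem _, ?_⟩
    have : mulDiff (1 : ℕ → G) = 1 := by funext n; simp [mulDiff]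
    rw [this]
    exact ih _

lemma mulDiff_mul (f g : ℕ → G) : mulDiff (f * g) = mulDiff f * ⁅f, mulDiff g⁆ * mulDiff g := by
  funext n
  simp [mulDiff, commutatorElement_def, mul_assoc]

lemma mulDiff_inv (f : ℕ → G) : mulDiff f⁻¹ = ⁅f⁻¹, (mulDiff f)⁻¹⁆ * (mulDiff f)⁻¹ := by
  funext n
  simp [mulDiff, commutatorElement_def, mul_assoc]

lemma mulDiff_commutator (f g : ℕ → G) :
    mulDiff ⁅f, g⁆ =
      ⁅mulDiff f, ⁅f, mulDiff g⁆⁆ * ⁅f, mulDiff g⁆ * ⁅mulDiff f * mulDiff g, ⁅f, g⁆⁆ *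
        (⁅⁅f, g⁆, ⁅mulDiff f, mulDiff g * g⁆⁆ * ⁅mulDiff f, mulDiff g * g⁆) := by
  funext n
  simp [mulDiff, commutatorElement_def, mul_assoc]

/-- The Lazard–Leibman theorem, for sequences with finitely many controlled differences. -/
lemma polyUpTo_closed (hH : IsCommFiltration H) (d : ℕ) :
    (∀ i f g, PolyUpTo H d i f → PolyUpTo H d i g → PolyUpTo H d i (f * g)) ∧
    (∀ i f, PolyUpTo H d i f → PolyUpTo H d i f⁻¹) ∧
    (∀ i j f g, PolyUpTo H d i f → PolyUpTo H d j g → PolyUpTo H d (i + j) ⁅f, g⁆) := by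
  induction d with
  | zero =>
    exact ⟨fun i f g hf hg n => mul_mem (hf n) (hg n), fun i f hf n => inv_mem (hf n),
      fun i j f g hf hg n => hH.comm (hf n) (hg n)⟩
  | succ d ih =>
    obtain ⟨hmul, hinv, hcomm⟩ := ih
    refine ⟨fun i f g hf hg => ⟨fun n => mul_mem (hf.1 n) (hg.1 n), ?_⟩,
      fun i f hf => ⟨fun n => inv_mem (hf.1 n), ?_⟩,
      fun i j f g hf hg => ⟨fun n => hH.comm (hf.1 n) (hg.1 n), ?_⟩⟩
    · rw [mulDiff_mul]
      exact hmul _ _ _ (hmul _ _ _ hf.2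
        ((hcomm _ _ _ _ hf.of_succ hg.2).mono hH.anti (by omega))) hg.2
    · rw [mulDiff_inv]
      exact hmul _ _ _ ((hcomm _ _ _ _ (hinv _ _ hf.of_succ) (hinv _ _ hf.2)).mono hH.anti
        (by omega)) (hinv _ _ hf.2)
    · rw [mulDiff_commutator]
      have hA := hcomm _ _ _ _ hf.of_succ hg.2
      have hB := hcomm _ _ _ _ hf.2
        (hmul _ _ _ (hg.2.mono hH.anti (Nat.le_succ j)) hg.of_succ)
      have hC := hcomm _ _ _ _ hf.of_succ hg.of_succ
      have hD := hmul 1 _ _ (hf.2.mono hH.anti (by omega)) (hg.2.mono hH.anti (by omega))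
      refine hmul _ _ _ (hmul _ _ _ (hmul _ _ _ ?_ ?_) ?_) (hmul _ _ _ ?_ ?_)
      · exact (hcomm _ _ _ _ hf.2 hA).mono hH.anti (by omega)
      · exact hA.mono hH.anti (by omega)
      · exact (hcomm _ _ _ _ hD hC).mono hH.anti (by omega)
      · exact (hcomm _ _ _ _ hC hB).mono hH.anti (by omega)
      · exact hB.mono hH.anti (by omega)

/-- The group of polynomial sequences with respect to a filtration, starting at index `i`. -/
def polySeq (hH : IsCommFiltration H) (i : ℕ) : Subgroup (ℕ → G) where
  carrier := {f | ∀ d, PolyUpTo H d i f}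
  one_mem' d := PolyUpTo.one d i
  mul_mem' hf hg d := (polyUpTo_closed hH d).1 _ _ _ (hf d) (hg d)
  inv_mem' hf d := (polyUpTo_closed hH d).2.1 _ _ (hf d)

lemma commutator_mem_polySeq {hH : IsCommFiltration H} {i j : ℕ} {f g : ℕ → G}
    (hf : f ∈ polySeq hH i) (hg : g ∈ polySeq hH j) : ⁅f, g⁆ ∈ polySeq hH (i + j) :=
  fun d => (polyUpTo_closed hH d).2.2 _ _ _ _ (hf d) (hg d)

lemma mulDiff_zpow (z : G) (q : ℕ → ℤ) :
    mulDiff (fun n => z ^ q n) = fun n => z ^ (Δ_[1] q) n := by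
  funext n
  simp [mulDiff, fwdDiff, zpow_sub]

lemma zpow_mem_polySeq (hH : IsCommFiltration H) {i e : ℕ} {z : G} (hz : z ∈ H (i + e))
    {q : ℕ → ℤ} (hq : (Δ_[1])^[e + 1] q = 0) : (fun n => z ^ q n) ∈ polySeq hH i := by
  intro d
  induction d generalizing i e q with
  | zero => exact fun n => zpow_mem (hH.anti (Nat.le_add_right i e) hz) _
  | succ d ih =>
    refine ⟨fun n => zpow_mem (hH.anti (Nat.le_add_right i e) hz) _, ?_⟩
    rw [mulDiff_zpow]
    cases e with
    | zero =>
      have hq' : Δ_[1] q = 0 := hq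
      rw [hq']
      simp only [Pi.zero_apply, zpow_zero]
      exact PolyUpTo.one d (i + 1)
    | succ e =>
      exact ih (e := e) (by rwa [add_right_comm]) (by rwa [Function.iterate_succ_apply] at hq)

lemma choose_mem_polySeq (hH : IsCommFiltration H) {i j : ℕ} {z : G} (hz : z ∈ H (i + j)) :
    (fun n => z ^ n.choose j) ∈ polySeq hH i := by
  have h0 : (Δ_[1])^[j + 1] (fun n => (n.choose j : ℤ)) = (0 : ℕ → ℤ) := by
    have := fwdDiff_iter_choose 0 j
    simp only [add_zero] at this
    rw [Function.iterate_succ_apply', this]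
    funext n
    simp [fwdDiff]
  simpa using zpow_mem_polySeq hH hz h0

lemma pow_mem_polySeq (hH : IsCommFiltration H) {i e l : ℕ} (hl : l ≤ e) {z : G}
    (hz : z ∈ H (i + e)) : (fun n => z ^ n ^ l) ∈ polySeq hH i := by
  have hsemi : Function.Semiconj (fun (q : ℤ → ℤ) (n : ℕ) => q n) (Δ_[1]) (Δ_[1]) := by
    intro q
    funext n
    simp [fwdDiff]
  have h0 : (Δ_[1])^[e + 1] (fun n : ℕ => (n : ℤ) ^ l) = 0 := by
    have := hsemi.iterate_right (e + 1) (fun r : ℤ => r ^ l)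
    rw [fwdDiff_iter_pow_eq_zero_of_lt (Nat.lt_succ_of_le hl)] at this
    exact this.symm
  have heq : (fun n : ℕ => z ^ ((n : ℤ) ^ l)) = fun n => z ^ n ^ l := by
    funext n
    rw [← Nat.cast_pow, zpow_natCast]
  exact heq ▸ zpow_mem_polySeq hH hz h0

lemma mulDiff_iterate_mem {d i : ℕ} {f : ℕ → G} (hf : PolyUpTo H d i f) (n : ℕ) :
    mulDiff^[d] f n ∈ H (i + d) := by
  induction d generalizing i f with
  | zero => exact hf n
  | succ d ih =>
    rw [Function.iterate_succ_apply]
    have := ih hf.2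
    rwa [add_assoc, add_comm 1 d] at this

lemma mulDiff_iterate_eq {k m : ℕ} {f : ℕ → G} (hf : ∀ t < m + k, f t = 1) :
    mulDiff^[k] f m = f (m + k) := by
  induction k generalizing f with
  | zero => rfl
  | succ k ih =>
    rw [Function.iterate_succ_apply, ih]
    · simp [mulDiff, hf (m + k) (by omega), add_assoc]
    · intro t ht
      simp [mulDiff, hf t (by omega), hf (t + 1) (by omega)]

lemma apply_mem_of_forall_lt {hH : IsCommFiltration H} {i k : ℕ} {f : ℕ → G}
    (hf : f ∈ polySeq hH i) (h1 : ∀ t < k, f t = 1) : f k ∈ H (i + k) := by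
  have h := mulDiff_iterate_eq (m := 0) (k := k) (f := f) (by simpa using h1)
  rw [zero_add] at h
  exact h ▸ mulDiff_iterate_mem (hf k) 0

/-- Taylor expansion: if the filtration terminates, the polynomial sequences are generated
by the binomial ones. -/
lemma polySeq_le (hH : IsCommFiltration H) {i d : ℕ} (hd : H (i + d) = ⊥)
    {N : Subgroup (ℕ → G)}
    (hN : ∀ j, ∀ z ∈ H (i + j), (fun n => z ^ n.choose j) ∈ N) : polySeq hH i ≤ N := by
  suffices h : ∀ m k, k + m = d → ∀ f ∈ polySeq hH i, (∀ t < k, f t = 1) → f ∈ N from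
    fun f hf => h d 0 (zero_add d) f hf (by simp)
  intro m
  induction m with
  | zero =>
    intro k hk f hf h1
    have hf1 : ∀ n, f n = 1 := by
      intro n
      induction n using Nat.strong_induction_on with
      | _ n ih =>
        by_cases hn : n < k
        · exact h1 n hn
        · have := hH.anti (show i + d ≤ i + n by omega) (apply_mem_of_forall_lt hf ih)
          rwa [hd, Subgroup.mem_bot] at this
    have : f = 1 := funext hf1
    rw [this]
    exact one_mem N
  | succ m ih =>
    intro k hk f hf h1
    have hc := apply_mem_of_forall_lt hf h1
    have he := hN k _ hc
    have := ih (k + 1) (by omega) _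
      (mul_mem (inv_mem (choose_mem_polySeq hH hc)) hf) (by
        intro t ht
        rcases Nat.lt_succ_iff_lt_or_eq.mp ht with ht | rfl
        · simp [Nat.choose_eq_zero_of_lt ht, h1 t ht]
        · simp)
    simpa using mul_mem he this

lemma IsCommFiltration.inf_normal (hH : IsCommFiltration H) (K : Subgroup G) [K.Normal] :
    IsCommFiltration fun i => H i ⊓ K where
  anti _ _ h := inf_le_inf_right K (hH.anti h)
  comm hx hy := ⟨hH.comm hx.1 hy.1, Subgroup.commutator_le_right K K
    (Subgroup.commutator_mem_commutator hx.2 hy.2)⟩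

lemma mem_polySeq_inf {hH : IsCommFiltration H} (K : Subgroup G) [K.Normal] {i : ℕ} {f : ℕ → G}
    (hf : f ∈ polySeq hH i) (hK : ∀ n, f n ∈ K) : f ∈ polySeq (hH.inf_normal K) i := by
  have key : ∀ d i f, PolyUpTo H d i f → (∀ n, f n ∈ K) → PolyUpTo (fun i => H i ⊓ K) d i f := by
    intro d
    induction d with
    | zero => exact fun i f hf hK n => ⟨hf n, hK n⟩
    | succ d ih =>
      exact fun i f hf hK => ⟨fun n => ⟨hf.1 n, hK n⟩,
        ih _ _ hf.2 fun n => mul_mem (hK _) (inv_mem (hK _))⟩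
  exact fun d => key d i f (hf d) hK

end PolynomialSequences

section LowerCentralSeries

variable {G : Type*} [Group G]

lemma commutator_lowerCentralSeries_mem {i j : ℕ} {a b : G}
    (ha : a ∈ (⊤ : Subgroup G).lowerCentralSeries i)
    (hb : b ∈ (⊤ : Subgroup G).lowerCentralSeries j) :
    ⁅a, b⁆ ∈ (⊤ : Subgroup G).lowerCentralSeries (i + j + 1) := by
  induction j generalizing i a b with
  | zero => exact Subgroup.commutator_mem_commutator ha (Subgroup.mem_top b)
  | succ j ih =>
    set K := (⊤ : Subgroup G).lowerCentralSeries (i + (j + 1) + 1) with hK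
    have hconj : ∀ x y : G, x ∈ K → y * x * y⁻¹ ∈ K := fun x y hx =>
      Subgroup.Normal.conj_mem inferInstance x hx y
    rw [Subgroup.mem_lowerCentralSeries_succ_iff] at hb
    induction hb using Subgroup.closure_induction generalizing a with
    | mem x hx =>
      obtain ⟨b, hb, c, -, rfl⟩ := hx
      have h2 : ⁅b⁻¹, ⁅c⁻¹, a⁆⁆ ∈ K := by
        rw [← inv_mem_iff, commutatorElement_inv]
        have : ⁅c⁻¹, a⁆ ∈ (⊤ : Subgroup G).lowerCentralSeries (i + 1) := by
          rw [← inv_mem_iff, commutatorElement_inv]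
          exact Subgroup.commutator_mem_commutator ha (Subgroup.mem_top _)
        have := ih this (inv_mem hb)
        rwa [show i + 1 + j + 1 = i + (j + 1) + 1 by omega] at this
      have h3 : ⁅c, ⁅a⁻¹, b⁻¹⁆⁆ ∈ K := by
        rw [← inv_mem_iff, commutatorElement_inv]
        exact Subgroup.commutator_mem_commutator (ih (inv_mem ha) (inv_mem hb)) (Subgroup.mem_top _)
      have hw := conj_commutatorElement_right_commutatorElement_mul a b⁻¹ c
      rw [inv_inv] at hw
      have h1 : b⁻¹ * ⁅a, ⁅b, c⁆⁆ * b =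
          (c * ⁅b⁻¹, ⁅c⁻¹, a⁆⁆ * c⁻¹ * (a * ⁅c, ⁅a⁻¹, b⁻¹⁆⁆ * a⁻¹))⁻¹ := by
        rw [eq_inv_iff_mul_eq_one, ← hw]
        group
      have h4 := inv_mem (mul_mem (hconj _ c h2) (hconj _ a h3))
      rw [← h1] at h4
      simpa [mul_assoc] using hconj _ b h4
    | one => simp [one_mem]
    | mul x y _ _ hx hy =>
      rw [commutatorElement_mul_right_eq_mul_conj, mul_assoc, mul_assoc, ← mul_assoc x]
      exact mul_mem (hx ha) (hconj _ _ (hy ha))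
    | inv x _ hx =>
      rw [commutatorElement_inv_right, ← commutatorElement_inv]
      simpa using hconj _ x⁻¹ (inv_mem (hx ha))

/-- The lower central series indexed from `1`, extended by the whole group at index `0`. -/
def gammaSeries (G : Type*) [Group G] (i : ℕ) : Subgroup G :=
  (⊤ : Subgroup G).lowerCentralSeries (i - 1)

instance (i : ℕ) : (gammaSeries G i).Normal :=
  inferInstanceAs ((⊤ : Subgroup G).lowerCentralSeries (i - 1)).Normal

lemma isCommFiltration_gammaSeries : IsCommFiltration (gammaSeries G) where
  anti _ _ h := Subgroup.lowerCentralSeries_antitone _ (Nat.sub_le_sub_right h 1)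
  comm hx hy := Subgroup.lowerCentralSeries_antitone _ (by omega)
    (commutator_lowerCentralSeries_mem hx hy)

end LowerCentralSeries

section Distortion

variable {G : Type*} [Group G]

/-- Subadditive, symmetric length functions on a group. -/
structure IsGroupLength (ℓ : G → ℕ) : Prop where
  one : ℓ 1 = 0
  mul : ∀ x y, ℓ (x * y) ≤ ℓ x + ℓ y
  inv : ∀ x, ℓ x⁻¹ ≤ ℓ x

variable {ℓ : G → ℕ}

lemma IsGroupLength.pow (hℓ : IsGroupLength ℓ) (x : G) (n : ℕ) : ℓ (x ^ n) ≤ n * ℓ x := by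
  induction n with
  | zero => simp [hℓ.one]
  | succ n ih =>
    rw [pow_succ, add_mul, one_mul]
    exact (hℓ.mul _ _).trans (Nat.add_le_add_right ih _)

/-- The sequences of at most linear length. -/
def linearSeq (hℓ : IsGroupLength ℓ) : Subgroup (ℕ → G) where
  carrier := {f | ∃ C, ∀ n, ℓ (f n) ≤ C * (n + 1)}
  one_mem' := ⟨0, fun n => by simp [hℓ.one]⟩
  mul_mem' := by
    rintro f g ⟨C, hC⟩ ⟨D, hD⟩
    refine ⟨C + D, fun n => (hℓ.mul _ _).trans ?_⟩
    rw [add_mul]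
    exact add_le_add (hC n) (hD n)
  inv_mem' := by
    rintro f ⟨C, hC⟩
    exact ⟨C, fun n => (hℓ.inv _).trans (hC n)⟩

lemma pow_mem_linearSeq (hℓ : IsGroupLength ℓ) (z : G) : (fun n => z ^ n) ∈ linearSeq hℓ :=
  ⟨ℓ z, fun n => (hℓ.pow z n).trans (by nlinarith)⟩

lemma const_mem_linearSeq (hℓ : IsGroupLength ℓ) (z : G) : (fun _ => z) ∈ linearSeq hℓ :=
  ⟨ℓ z, fun n => by nlinarith⟩

lemma commutator_pow_mul_central {a b κ : G} (hκ : κ ∈ Subgroup.center G)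
    (ha : ∀ y, ⁅a, y⁆ ∈ Subgroup.center G) (m n : ℕ) :
    ⁅a ^ m * κ, b ^ n⁆ = ⁅a, b⁆ ^ (m * n) := by
  have hc : ∀ y g, g * ⁅a, y⁆ = ⁅a, y⁆ * g := fun y => Subgroup.mem_center_iff.mp (ha y)
  have h1 : ∀ n, ⁅a, b ^ n⁆ = ⁅a, b⁆ ^ n := by
    intro n
    induction n with
    | zero => simp
    | succ n ih =>
      rw [pow_succ b, commutatorElement_mul_right_eq_mul_conj, mul_assoc ⁅a, b ^ n⁆, hc,
        ih, pow_succ]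
      group
  have h2 : ∀ m, ⁅a ^ m, b ^ n⁆ = ⁅a, b ^ n⁆ ^ m := by
    intro m
    induction m with
    | zero => simp
    | succ m ih =>
      rw [pow_succ a, commutatorElement_mul_left_eq_conj_mul, hc, ih, pow_succ']
      group
  have h3 : ⁅κ, b ^ n⁆ = 1 :=
    commutatorElement_eq_one_iff_mul_comm.mpr (Subgroup.mem_center_iff.mp hκ _).symm
  rw [commutatorElement_mul_left_eq_conj_mul, h3, h2, h1, mul_one, mul_inv_cancel, one_mul,
    ← pow_mul, mul_comm]

/-- Powers `z ^ n ^ l` of an element of the `k`-th term of the lower central series are, for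
`l ≤ k + 1`, congruent modulo the next term to polynomial sequences of linear length. -/
lemma exists_linearSeq_congr (hℓ : IsGroupLength ℓ) {k l : ℕ} (hl : l ≤ k + 1) {z : G}
    (hz : z ∈ (⊤ : Subgroup G).lowerCentralSeries k) :
    ∃ x ∈ polySeq (isCommFiltration_gammaSeries (G := G)) 0 ⊓ linearSeq hℓ, ∀ n,
      (x n : G ⧸ (⊤ : Subgroup G).lowerCentralSeries (k + 1)) = (z : G ⧸ _) ^ n ^ l := by
  induction k generalizing l z with
  | zero =>
    refine ⟨fun n => z ^ n ^ l, ⟨?_, ?_⟩, fun n => rfl⟩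
    · exact pow_mem_polySeq _ (e := 1) hl (Subgroup.mem_top z)
    · interval_cases l
      · simpa using const_mem_linearSeq hℓ z
      · simpa using pow_mem_linearSeq hℓ z
  | succ k ih =>
    cases l with
    | zero =>
      refine ⟨fun n => z, ⟨?_, const_mem_linearSeq hℓ z⟩, fun n => by rw [pow_zero, pow_one]⟩
      simpa using pow_mem_polySeq isCommFiltration_gammaSeries (i := 0) (l := 0) (e := 0) le_rfl
        (Subgroup.mem_top z)
    | succ l =>
      rw [Subgroup.mem_lowerCentralSeries_succ_iff] at hz
      have hcen : ∀ w ∈ (⊤ : Subgroup G).lowerCentralSeries (k + 1),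
          (w : G ⧸ (⊤ : Subgroup G).lowerCentralSeries (k + 1 + 1)) ∈ Subgroup.center _ := by
        intro w hw
        rw [Subgroup.mem_center_iff]
        intro g
        obtain ⟨g, rfl⟩ := QuotientGroup.mk_surjective g
        refine (commutatorElement_eq_one_iff_mul_comm.mp ?_).symm
        refine (QuotientGroup.eq_one_iff ⁅w, g⁆).mpr ?_
        exact Subgroup.commutator_mem_commutator hw (Subgroup.mem_top g)
      induction hz using Subgroup.closure_induction with
      | mem z hz =>
        obtain ⟨a, ha, b, -, rfl⟩ := hz
        obtain ⟨x, hxm, hx⟩ := ih (Nat.le_of_succ_le_succ hl) ha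
        obtain ⟨hxp, hxl⟩ := Subgroup.mem_inf.mp hxm
        have hbp : (fun n => b ^ n) ∈ polySeq (isCommFiltration_gammaSeries (G := G)) 0 := by
          simpa using pow_mem_polySeq (isCommFiltration_gammaSeries (G := G)) (i := 0) (l := 1)
            (e := 1) le_rfl (Subgroup.mem_top b)
        have hbl := pow_mem_linearSeq hℓ b
        refine ⟨⁅x, fun n => b ^ n⁆, ⟨commutator_mem_polySeq hxp hbp, ?_⟩, fun n => ?_⟩
        · rw [commutatorElement_def]
          exact (linearSeq hℓ).mul_mem ((linearSeq hℓ).mul_mem ((linearSeq hℓ).mul_mem hxl hbl)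
            ((linearSeq hℓ).inv_mem hxl)) ((linearSeq hℓ).inv_mem hbl)
        · have hκ : (a ^ n ^ l)⁻¹ * x n ∈ (⊤ : Subgroup G).lowerCentralSeries (k + 1) :=
            QuotientGroup.eq.mp (hx n).symm
          have hy : ∀ y : G ⧸ (⊤ : Subgroup G).lowerCentralSeries (k + 1 + 1),
              ⁅(a : G ⧸ (⊤ : Subgroup G).lowerCentralSeries (k + 1 + 1)), y⁆ ∈
                Subgroup.center _ := by
            intro y
            obtain ⟨y, rfl⟩ := QuotientGroup.mk_surjective y
            exact hcen ⁅a, y⁆ (Subgroup.commutator_mem_commutator ha (Subgroup.mem_top y))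
          have := commutator_pow_mul_central (b := QuotientGroup.mk b) (hcen _ hκ) hy (n ^ l) n
          rw [← pow_succ] at this
          refine Eq.trans ?_ this
          rw [QuotientGroup.mk_mul, QuotientGroup.mk_inv, QuotientGroup.mk_pow, mul_inv_cancel_left]
          rfl
      | one => exact ⟨1, one_mem _, fun n => (one_pow _).symm⟩
      | mul z w hz hw ihz ihw =>
        obtain ⟨x, hx, hxz⟩ := ihz
        obtain ⟨y, hy, hyw⟩ := ihw
        refine ⟨x * y, mul_mem hx hy, fun n => ?_⟩
        rw [Pi.mul_apply, QuotientGroup.mk_mul, QuotientGroup.mk_mul, hxz, hyw]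
        exact (Commute.mul_pow (Subgroup.mem_center_iff.mp (hcen w hw) _) _).symm
      | inv z _ ihz =>
        obtain ⟨x, hx, hxz⟩ := ihz
        refine ⟨x⁻¹, inv_mem hx, fun n => ?_⟩
        rw [Pi.inv_apply, QuotientGroup.mk_inv, QuotientGroup.mk_inv, hxz, inv_pow]

lemma succ_pow_le (p l : ℕ) : (p + 1) ^ (l + 1) ≤ p ^ (l + 1) + (l + 1) * (p + 1) ^ l := by
  induction l with
  | zero => simp
  | succ l ih =>
    have h1 : p * (p + 1) ^ (l + 1) ≤ p * (p ^ (l + 1) + (l + 1) * (p + 1) ^ l) :=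
      Nat.mul_le_mul_left p ih
    have h2 : 0 ≤ (l + 1) * (p + 1) ^ l := Nat.zero_le _
    ring_nf at h1 h2 ⊢
    nlinarith

/-- If all the powers `z ^ p ^ l` have length `O(p)`, then `z ^ m` has length `O(r)` whenever
`m ≤ r ^ i`. -/
lemma length_pow_le_of_forall (hℓ : IsGroupLength ℓ) {z : G} {i : ℕ}
    (hz : ∀ l ≤ i, (fun p => z ^ p ^ l) ∈ linearSeq hℓ) :
    ∃ C, ∀ r m, 1 ≤ r → m ≤ r ^ i → ℓ (z ^ m) ≤ C * r := by
  induction i with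
  | zero =>
    refine ⟨ℓ z, fun r m hr hm => (hℓ.pow z m).trans ?_⟩
    rw [mul_comm]
    exact Nat.mul_le_mul_left _ (by simpa using hm.trans (by simpa using hr))
  | succ l ih =>
    obtain ⟨C, hC⟩ := ih fun l' hl' => hz l' (by omega)
    obtain ⟨D, hD⟩ := hz (l + 1) le_rfl
    set K := (l + 1) * 2 ^ l with hK
    have hK1 : 1 ≤ K := Nat.mul_pos (by omega) (by positivity)
    refine ⟨2 * D + C * K, fun r m hr hm => ?_⟩
    obtain ⟨p, hp1, hp2⟩ : ∃ p, p ^ (l + 1) ≤ m ∧ m < (p + 1) ^ (l + 1) :=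
      ⟨_, (Nat.le_nthRoot_iff (by omega)).mp le_rfl, Nat.lt_pow_nthRoot_add_one (by omega) m⟩
    have hpr : p ≤ r := (Nat.pow_le_pow_iff_left (by omega)).mp (hp1.trans hm)
    obtain ⟨m', rfl⟩ := Nat.exists_eq_add_of_le hp1
    have hm' : m' ≤ (K * r) ^ l := by
      have h1 : m' ≤ (l + 1) * (p + 1) ^ l := by have := succ_pow_le p l; omega
      have h2 : (p + 1) ^ l ≤ (2 * r) ^ l := Nat.pow_le_pow_left (by omega) l
      have h3 : K ≤ K ^ l := by
        rcases Nat.eq_zero_or_pos l with rfl | hl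
        · simp [hK]
        · exact Nat.le_self_pow hl.ne' K
      calc m' ≤ (l + 1) * (2 * r) ^ l := h1.trans (Nat.mul_le_mul_left _ h2)
        _ = K * r ^ l := by rw [hK, mul_pow, mul_assoc]
        _ ≤ K ^ l * r ^ l := Nat.mul_le_mul_right _ h3
        _ = (K * r) ^ l := (mul_pow _ _ _).symm
    rw [pow_add]
    calc ℓ (z ^ p ^ (l + 1) * z ^ m') ≤ ℓ (z ^ p ^ (l + 1)) + ℓ (z ^ m') := hℓ.mul _ _
      _ ≤ D * (p + 1) + C * (K * r) :=
        add_le_add (hD p) (hC _ _ (Nat.mul_pos hK1 hr) hm')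
      _ ≤ D * (2 * r) + C * (K * r) :=
        Nat.add_le_add_right (Nat.mul_le_mul_left _ (by omega)) _
      _ = (2 * D + C * K) * r := by ring

/-- Distortion of the lower central series in a nilpotent group. -/
theorem exists_length_pow_le [Group.IsNilpotent G] (hℓ : IsGroupLength ℓ) {k : ℕ} {z : G}
    (hz : z ∈ (⊤ : Subgroup G).lowerCentralSeries k) :
    ∃ C, ∀ r m, 1 ≤ r → m ≤ r ^ (k + 1) → ℓ (z ^ m) ≤ C * r := by
  obtain ⟨c, hc⟩ := Subgroup.nilpotent_iff_lowerCentralSeries.mp ‹Group.IsNilpotent G›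
  suffices h : ∀ s k, c ≤ k + s → ∀ z ∈ (⊤ : Subgroup G).lowerCentralSeries k,
      ∃ C, ∀ r m, 1 ≤ r → m ≤ r ^ (k + 1) → ℓ (z ^ m) ≤ C * r from h c k (by omega) z hz
  clear hz z k
  intro s
  induction s with
  | zero =>
    intro k hk z hz
    have : z = 1 := by
      have := Subgroup.lowerCentralSeries_antitone ⊤ hk hz
      simpa [hc] using this
    exact ⟨0, fun r m _ _ => by simp [this, hℓ.one]⟩
  | succ s ih =>
    intro k hk z hz
    refine length_pow_le_of_forall hℓ fun l hl => ?_
    obtain ⟨x, hxm, hx⟩ := exists_linearSeq_congr hℓ hl hz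
    obtain ⟨hxp, hxl⟩ := Subgroup.mem_inf.mp hxm
    have hzp : (fun p => z ^ p ^ l) ∈ polySeq (isCommFiltration_gammaSeries (G := G)) 0 :=
      pow_mem_polySeq _ hl (by simpa [gammaSeries] using hz)
    have hf := mem_polySeq_inf (gammaSeries G (k + 2)) (mul_mem (inv_mem hxp) hzp)
      fun n => QuotientGroup.eq.mp (hx n)
    have hbot : gammaSeries G (0 + (c + 1)) ⊓ gammaSeries G (k + 2) = ⊥ := by
      simp [gammaSeries, hc]
    have := polySeq_le _ hbot (N := linearSeq hℓ) (fun j w hw => ?_) hf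
    · simpa using mul_mem hxl this
    · rw [zero_add] at hw
      have hmax : ∃ k', k + 1 ≤ k' ∧ j ≤ k' + 1 ∧
          w ∈ (⊤ : Subgroup G).lowerCentralSeries k' := by
        rcases le_total j (k + 2) with h | h
        · exact ⟨k + 1, le_rfl, h, hw.2⟩
        · exact ⟨j - 1, by omega, by omega, hw.1⟩
      obtain ⟨k', hk', hj, hw'⟩ := hmax
      obtain ⟨C, hC⟩ := ih k' (by omega) w hw'
      refine ⟨C, fun n => hC (n + 1) _ (by omega) ?_⟩
      calc n.choose j ≤ n ^ j := Nat.choose_le_pow n j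
        _ ≤ (n + 1) ^ j := Nat.pow_le_pow_left (by omega) j
        _ ≤ (n + 1) ^ (k' + 1) := Nat.pow_le_pow_right (by omega) hj

end Distortion

section Sublinear

open Asymptotics

variable {G : Type*} [Group G] {ℓ : G → ℕ}

/-- The sequences of sublinear length. -/
def sublinearSeq (hℓ : IsGroupLength ℓ) : Subgroup (ℕ → G) where
  carrier := {f | (fun n => (ℓ (f n) : ℝ)) =o[atTop] (fun n : ℕ => (n : ℝ))}
  one_mem' := by simp [hℓ.one]
  mul_mem' := by
    intro f g hf hg
    refine IsBigO.trans_isLittleO (IsBigO.of_norm_le fun n => ?_) (hf.add hg)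
    rw [Real.norm_natCast]
    exact_mod_cast hℓ.mul _ _
  inv_mem' := by
    intro f hf
    refine IsBigO.trans_isLittleO (IsBigO.of_norm_le fun n => ?_) hf
    rw [Real.norm_natCast]
    exact_mod_cast hℓ.inv _

lemma mem_sublinearSeq {hℓ : IsGroupLength ℓ} {f : ℕ → G} :
    f ∈ sublinearSeq hℓ ↔ (fun n => (ℓ (f n) : ℝ)) =o[atTop] (fun n : ℕ => (n : ℝ)) := Iff.rfl

lemma ceil_rpow_isLittleO (j : ℕ) :
    (fun n : ℕ => ((⌈(n : ℝ) ^ ((j : ℝ) / (j + 1))⌉₊ + 1 : ℕ) : ℝ)) =o[atTop]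
      (fun n : ℕ => (n : ℝ)) := by
  have h1 : (fun n : ℕ => (n : ℝ) ^ ((j : ℝ) / (j + 1))) =o[atTop] (fun n : ℕ => (n : ℝ)) := by
    have h : (j : ℝ) / (j + 1) < 1 := by
      rw [div_lt_one (by positivity)]
      linarith
    have h0 := (tendsto_rpow_neg_atTop (sub_pos.mpr h)).comp
      (tendsto_natCast_atTop_atTop (R := ℝ))
    refine (isLittleO_iff_tendsto' ?_).mpr (h0.congr' ?_)
    · filter_upwards [eventually_ge_atTop 1] with n hn h
      exact absurd h (by positivity)
    · filter_upwards [eventually_ge_atTop 1] with n hn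
      rw [Function.comp_apply, neg_sub, Real.rpow_sub_one (by positivity)]
  have h2 : (fun _ : ℕ => (2 : ℝ)) =o[atTop] (fun n : ℕ => (n : ℝ)) :=
    isLittleO_const_left.mpr (Or.inr (tendsto_norm_atTop_atTop.comp tendsto_natCast_atTop_atTop))
  refine IsBigO.trans_isLittleO (IsBigO.of_norm_le fun n => ?_) (h1.add h2)
  rw [Real.norm_natCast]
  have := Nat.ceil_lt_add_one (show 0 ≤ (n : ℝ) ^ ((j : ℝ) / (j + 1)) by positivity)
  push_cast
  linarith

lemma pow_le_ceil_rpow_pow (j n : ℕ) :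
    n ^ j ≤ (⌈(n : ℝ) ^ ((j : ℝ) / (j + 1))⌉₊ + 1) ^ (j + 1) := by
  have h : (n : ℝ) ^ j ≤ ((⌈(n : ℝ) ^ ((j : ℝ) / (j + 1))⌉₊ + 1 : ℕ) : ℝ) ^ (j + 1) := by
    calc (n : ℝ) ^ j = ((n : ℝ) ^ ((j : ℝ) / (j + 1))) ^ (j + 1) := by
          rw [← Real.rpow_natCast _ (j + 1), ← Real.rpow_mul (by positivity)]
          push_cast
          rw [div_mul_cancel₀ _ (by positivity), Real.rpow_natCast]
      _ ≤ _ := by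
          refine pow_le_pow_left₀ (by positivity) ((Nat.le_ceil _).trans ?_) _
          push_cast
          linarith
  exact_mod_cast h

theorem conj_pow_mem_sublinearSeq [Group.IsNilpotent G] (hℓ : IsGroupLength ℓ) (g h : G) :
    (fun n => g ^ n * h * (g ^ n)⁻¹) ∈ sublinearSeq hℓ := by
  obtain ⟨c, hc⟩ := Subgroup.nilpotent_iff_lowerCentralSeries.mp ‹Group.IsNilpotent G›
  have hF := isCommFiltration_gammaSeries (G := G)
  have hg : (fun n => g ^ n) ∈ polySeq hF 0 := by
    simpa using pow_mem_polySeq hF (i := 0) (l := 1) (e := 1) le_rfl (Subgroup.mem_top g)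
  have hh : (fun _ => h) ∈ polySeq hF 1 := by
    simpa using pow_mem_polySeq hF (i := 1) (l := 0) (e := 0) le_rfl (Subgroup.mem_top h)
  have hgh := mul_mem (commutator_mem_polySeq hg hh) hh
  have heq : ⁅fun n => g ^ n, fun _ => h⁆ * (fun _ => h) = fun n => g ^ n * h * (g ^ n)⁻¹ := by
    funext n
    simp [commutatorElement_def]
  rw [heq] at hgh
  have hbot : gammaSeries G (0 + 1 + c) = ⊥ := by simpa [gammaSeries] using hc
  refine polySeq_le hF hbot (fun j z hz => ?_) hgh
  have hz' : z ∈ (⊤ : Subgroup G).lowerCentralSeries j := by simpa [gammaSeries] using hz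
  obtain ⟨C, hC⟩ := exists_length_pow_le hℓ hz'
  refine IsBigO.trans_isLittleO (IsBigO.of_norm_le fun n => ?_)
    ((ceil_rpow_isLittleO j).const_mul_left (C : ℝ))
  rw [Real.norm_natCast]
  exact_mod_cast hC _ _ (by omega) ((Nat.choose_le_pow n j).trans (pow_le_ceil_rpow_pow j n))

end Sublinear

section WordLength

variable {G : Type*} [Group G] {S : Set G}

lemma exists_list_length_eq_wlen (hSsymm : ∀ s ∈ S, s⁻¹ ∈ S) (hSgen : Subgroup.closure S = ⊤)
    (g : G) : ∃ l : List G, (∀ s ∈ l, s ∈ S) ∧ l.length = wlen S g ∧ l.prod = g := by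
  refine Nat.sInf_mem (s := {n | ∃ l : List G, (∀ s ∈ l, s ∈ S) ∧ l.length = n ∧ l.prod = g}) ?_
  have hg : g ∈ (Subgroup.closure S).toSubmonoid := hSgen ▸ Subgroup.mem_top g
  rw [Subgroup.closure_toSubmonoid] at hg
  obtain ⟨l, hl, hprod⟩ := Submonoid.exists_list_of_mem_closure hg
  refine ⟨l.length, l, fun s hs => ?_, rfl, hprod⟩
  rcases hl s hs with h | h
  · exact h
  · simpa using hSsymm _ h

lemma wlen_prod_le {l : List G} (hl : ∀ s ∈ l, s ∈ S) : wlen S l.prod ≤ l.length :=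
  Nat.sInf_le ⟨l, hl, rfl, rfl⟩

lemma isGroupLength_wlen (hSsymm : ∀ s ∈ S, s⁻¹ ∈ S) (hSgen : Subgroup.closure S = ⊤) :
    IsGroupLength (wlen S) where
  one := Nat.le_zero.mp (wlen_prod_le (l := []) (by simp))
  mul x y := by
    obtain ⟨l, hl, hlen, hprod⟩ := exists_list_length_eq_wlen hSsymm hSgen x
    obtain ⟨l', hl', hlen', hprod'⟩ := exists_list_length_eq_wlen hSsymm hSgen y
    rw [← hlen, ← hlen', ← List.length_append, ← hprod, ← hprod', ← List.prod_append]
    refine wlen_prod_le fun s hs => ?_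
    rcases List.mem_append.mp hs with h | h
    exacts [hl s h, hl' s h]
  inv x := by
    obtain ⟨l, hl, hlen, hprod⟩ := exists_list_length_eq_wlen hSsymm hSgen x
    rw [← hlen, ← hprod, List.prod_inv_reverse]
    refine (wlen_prod_le fun s hs => ?_).trans (by simp)
    obtain ⟨t, ht, rfl⟩ := List.mem_map.mp (List.mem_reverse.mp hs)
    exact hSsymm t (hl t ht)

end WordLength

theorem stmt6 {G : Type*} [Group G] [Group.IsNilpotent G]
    (S : Set G) (hSfin : S.Finite) (hSsymm : ∀ s ∈ S, s⁻¹ ∈ S)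
    (hSgen : Subgroup.closure S = ⊤) (g h : G) :
    Tendsto (fun n : ℕ => (wlen S (g ^ n * h * (g ^ n)⁻¹) : ℝ) / n) atTop (nhds 0) :=
  (mem_sublinearSeq.mp
    (conj_pow_mem_sublinearSeq (isGroupLength_wlen hSsymm hSgen) g h)).tendsto_div_nhds_zero
end

section
/- Let G and H be finitely generated nilpotent groups with finite symmetric generating sets, word lengths |·|_G, |·|_H and right-invariant word metrics d_G, d_H. Let (X,μ,T) be an ergodic probability G-space, let α : G × X → H be an integrable cocycle, and let M ≥ 1 be a constant such that μ{x : |α(g,x)|_H ≥ M·|g|_G} → 0 as |g|_G → ∞. Then for all ε > 0 and δ > 0 there is R₀ such that for all R ≥ R₀ and all g ∈ G: μ{x ∈ X : |B_G(g,R) ∩ {g' ∈ G : d_H(α_x(g'),α_x(g)) ≤ 2MR}| ≥ (1−ε)·|B_G(g,R)|} ≥ 1 − δ, where α_x(g) := α(g,x) and B_G(g,R) := {g' ∈ G : d_G(g',g) ≤ R}. -/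
open MeasureTheory Filter

theorem finite_wlen_le {G : Type*} [Group G] {S : Set G} (hfin : S.Finite)
    (hsymm : ∀ s ∈ S, s⁻¹ ∈ S) (hgen : Subgroup.closure S = ⊤) (R : ℝ) :
    {g : G | (wlen S g : ℝ) ≤ R}.Finite := by
  have : Finite S := hfin
  refine ((List.finite_length_le S ⌊R⌋₊).image (fun l => (l.map Subtype.val).prod)).subset ?_
  intro g hg
  have hne : {n : ℕ | ∃ l : List G, (∀ s ∈ l, s ∈ S) ∧ l.length = n ∧ l.prod = g}.Nonempty := by
    have hg : g ∈ Submonoid.closure (S ∪ S⁻¹) := by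
      rw [← Subgroup.closure_toSubmonoid, hgen]
      trivial
    obtain ⟨l, hl, hp⟩ := Submonoid.exists_list_of_mem_closure hg
    refine ⟨l.length, l, fun s hs => ?_, rfl, hp⟩
    rcases hl s hs with h | h
    · exact h
    · simpa using hsymm _ h
  obtain ⟨l, hl, hlen, hp⟩ := Nat.sInf_mem hne
  lift l to List S using hl
  refine ⟨l, ?_, hp⟩
  rw [List.length_map] at hlen
  have : l.length = wlen S g := hlen
  exact this.trans_le (Nat.le_floor hg)

theorem wlen_one {G : Type*} [Group G] (S : Set G) : wlen S 1 = 0 :=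
  Nat.sInf_eq_zero.2 (Or.inl ⟨[], by simp⟩)

/-- Markov's inequality for the number of events of a finite family that occur. -/
theorem measure_lt_card_filter_le {X ι : Type*} [MeasurableSpace X] (μ : Measure X)
    (B : Finset ι) (hB : B.Nonempty) (A : ι → X → Prop) [∀ x, DecidablePred fun k => A k x]
    (hA : ∀ k ∈ B, NullMeasurableSet {x | A k x} μ) {ε δ : ℝ} (hε : 0 < ε)
    (h : ∀ k ∈ B, μ {x | A k x} ≤ ENNReal.ofReal (ε * δ)) :
    NullMeasurableSet {x | ε * (B.card : ℝ) < ((B.filter fun k => A k x).card : ℝ)} μ ∧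
      μ {x | ε * (B.card : ℝ) < ((B.filter fun k => A k x).card : ℝ)} ≤ ENNReal.ofReal δ := by
  have hcard (x : X) : (∑ k ∈ B, {x | A k x}.indicator (1 : X → ENNReal) x) =
      ENNReal.ofReal ((B.filter fun k => A k x).card : ℝ) := by
    simp [Set.indicator_apply, Finset.sum_boole]
  have hmeas : ∀ k ∈ B, AEMeasurable ({x | A k x}.indicator (1 : X → ENNReal)) μ :=
    fun k hk => aemeasurable_one.indicator₀ (hA k hk)
  have hsum : AEMeasurable (fun x => ∑ k ∈ B, {x | A k x}.indicator (1 : X → ENNReal) x) μ :=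
    Finset.aemeasurable_fun_sum B hmeas
  have hpos : 0 < ε * (B.card : ℝ) := mul_pos hε (by exact_mod_cast hB.card_pos)
  have hset : {x | ε * (B.card : ℝ) < ((B.filter fun k => A k x).card : ℝ)} =
      {x | ENNReal.ofReal (ε * B.card) <
        ∑ k ∈ B, {x | A k x}.indicator (1 : X → ENNReal) x} := by
    ext x
    simp only [Set.mem_ofPred_eq, hcard]
    exact (ENNReal.ofReal_lt_ofReal_iff_of_nonneg hpos.le).symm
  rw [hset]
  refine ⟨nullMeasurableSet_lt aemeasurable_const hsum, ?_⟩
  have hpos' : ENNReal.ofReal (ε * B.card) ≠ 0 := by simpa using hpos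
  refine (measure_mono (Set.ofPred_subset_ofPred.2 fun x hx => hx.le)).trans
    ((meas_ge_le_lintegral_div hsum hpos' ENNReal.ofReal_ne_top).trans ?_)
  refine ENNReal.div_le_of_le_mul ?_
  rw [lintegral_finsetSum' _ hmeas]
  calc ∑ k ∈ B, ∫⁻ x, {x | A k x}.indicator (1 : X → ENNReal) x ∂μ
      = ∑ k ∈ B, μ {x | A k x} := Finset.sum_congr rfl fun k hk => lintegral_indicator_one₀ (hA k hk)
    _ ≤ ∑ k ∈ B, ENNReal.ofReal (ε * δ) := Finset.sum_le_sum h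
    _ = ENNReal.ofReal δ * ENNReal.ofReal (ε * B.card) := by
      rw [Finset.sum_const, nsmul_eq_mul, ENNReal.ofReal_mul hε.le, ENNReal.ofReal_mul hε.le,
        ENNReal.ofReal_natCast]
      ring

theorem exists_forall_measure_lt_le {X : Type*} [MeasurableSpace X] (μ : Measure X)
    [IsFiniteMeasure μ] {f : X → ℝ} (hf : Integrable f μ) (h0 : ∀ x, 0 ≤ f x) {η : ℝ} (hη : 0 < η) :
    ∃ t₀ : ℝ, ∀ t, t₀ ≤ t → μ {x | t < f x} ≤ ENNReal.ofReal η := by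
  refine ⟨max 1 ((∫ x, f x ∂μ) / η), fun t ht => ?_⟩
  have ht0 : 0 < t := one_pos.trans_le ((le_max_left _ _).trans ht)
  have hI : ∫ x, f x ∂μ ≤ t * η := (div_le_iff₀ hη).1 ((le_max_right _ _).trans ht)
  have hm := mul_meas_ge_le_integral_of_nonneg (ae_of_all μ h0) hf t
  refine (measure_mono (Set.ofPred_subset_ofPred.2 fun x hx => hx.le)).trans
    (?_ : μ {x | t ≤ f x} ≤ _)
  rw [← ofReal_measureReal]
  exact ENNReal.ofReal_le_ofReal (le_of_mul_le_mul_left (hm.trans hI) ht0)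

theorem stmt10 {G H : Type*} [Group G] [Group.IsNilpotent G]
    [Group H] [Group.IsNilpotent H]
    (SG : Set G) (hSGfin : SG.Finite) (hSGsymm : ∀ s ∈ SG, s⁻¹ ∈ SG)
    (hSGgen : Subgroup.closure SG = ⊤)
    (SH : Set H) (hSHfin : SH.Finite) (hSHsymm : ∀ s ∈ SH, s⁻¹ ∈ SH)
    (hSHgen : Subgroup.closure SH = ⊤)
    {X : Type*} [MeasurableSpace X] (μ : Measure X) [IsProbabilityMeasure μ]
    (T : G → X → X) (hTmeas : ∀ g, Measurable (T g))
    (hT1 : ∀ x, T 1 x = x) (hTmul : ∀ g h x, T (g * h) x = T g (T h x))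
    (hTpres : ∀ g, MeasurePreserving (T g) μ μ)
    (hErg : ∀ A : Set X, MeasurableSet A →
      (∀ g : G, μ (symmDiff (T g ⁻¹' A) A) = 0) → μ A = 0 ∨ μ A = 1)
    (α : G → X → H) (hαmeas : ∀ (g : G) (h : H), MeasurableSet {x | α g x = h})
    (hαcoc : ∀ g₁ g₂ : G, ∀ᵐ x ∂μ, α (g₁ * g₂) x = α g₁ (T g₂ x) * α g₂ x)
    (hαint : ∀ g : G, Integrable (fun x => (wlen SH (α g x) : ℝ)) μ)
    (M : ℝ) (hM : 1 ≤ M)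
    (hMconv : ∀ ε : ℝ, 0 < ε → ∃ N : ℕ, ∀ g : G, N ≤ wlen SG g →
      μ {x | M * (wlen SG g : ℝ) ≤ (wlen SH (α g x) : ℝ)} < ENNReal.ofReal ε) :
    ∀ ε δ : ℝ, 0 < ε → 0 < δ → ∃ R₀ : ℝ, ∀ R : ℝ, R₀ ≤ R → ∀ g : G,
      ENNReal.ofReal (1 - δ) ≤ μ {x |
        (1 - ε) * (({g' : G | (wlen SG (g' * g⁻¹) : ℝ) ≤ R}).ncard : ℝ) ≤
          (({g' : G | (wlen SG (g' * g⁻¹) : ℝ) ≤ R ∧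
            (wlen SH (α g' x * (α g x)⁻¹) : ℝ) ≤ 2 * M * R}).ncard : ℝ)} := by
  classical
  intro ε δ hε hδ
  have hη : 0 < ε * δ := mul_pos hε hδ
  obtain ⟨N, hN⟩ := hMconv (ε * δ) hη
  choose t ht using fun k : G => exists_forall_measure_lt_le μ (hαint k) (fun x => by positivity) hη
  obtain ⟨t₀, ht₀⟩ := ((finite_wlen_le hSGfin hSGsymm hSGgen N).image t).bddAbove
  refine ⟨max 0 t₀, fun R hR g => ?_⟩
  have hR0 : 0 ≤ R := (le_max_left _ _).trans hR
  have hRt : t₀ ≤ R := (le_max_right _ _).trans hR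
  have hMR : R ≤ 2 * M * R := by nlinarith
  set B := (finite_wlen_le hSGfin hSGsymm hSGgen R).toFinset with hBdef
  have hmemB (k : G) : k ∈ B ↔ (wlen SG k : ℝ) ≤ R := by simp [hBdef]
  have hBne : B.Nonempty := ⟨1, by simpa [hmemB, wlen_one] using hR0⟩
  have hsmall : ∀ k ∈ B, μ {x | 2 * M * R < (wlen SH (α k x) : ℝ)} ≤ ENNReal.ofReal (ε * δ) := by
    intro k hk
    rcases le_total N (wlen SG k) with hk' | hk'
    · refine (measure_mono fun x hx => ?_).trans (hN k hk').le
      have hx : 2 * M * R < (wlen SH (α k x) : ℝ) := hx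
      have hkR := (hmemB k).1 hk
      have : M * (wlen SG k : ℝ) ≤ M * R := by gcongr
      change M * (wlen SG k : ℝ) ≤ wlen SH (α k x)
      nlinarith
    · have : t k ≤ t₀ := ht₀ ⟨k, by simpa using hk', rfl⟩
      exact ht k _ (by linarith)
  obtain ⟨hEm, hE⟩ := measure_lt_card_filter_le μ B hBne
    (fun k x => 2 * M * R < (wlen SH (α k x) : ℝ))
    (fun k _ => nullMeasurableSet_lt aemeasurable_const (hαint k).aemeasurable) hε hsmall
  set E := {x | ε * (B.card : ℝ) <
    ((B.filter fun k => 2 * M * R < (wlen SH (α k x) : ℝ)).card : ℝ)} with hEdef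
  rw [← (hTpres g).measure_preimage hEm] at hE
  have hcoc : ∀ᵐ x ∂μ, ∀ k ∈ B, α (k * g) x = α k (T g x) * α g x :=
    (Finset.eventually_all B).2 fun k _ => hαcoc k g
  set S := {x | (1 - ε) * (({g' : G | (wlen SG (g' * g⁻¹) : ℝ) ≤ R}).ncard : ℝ) ≤
    (({g' : G | (wlen SG (g' * g⁻¹) : ℝ) ≤ R ∧
      (wlen SH (α g' x * (α g x)⁻¹) : ℝ) ≤ 2 * M * R}).ncard : ℝ)} with hSdef
  have hball : {g' : G | (wlen SG (g' * g⁻¹) : ℝ) ≤ R}.ncard = B.card := by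
    rw [← Set.ncard_coe_finset B, ← Set.ncard_image_of_injective (B : Set G) (mul_left_injective g)]
    congr 1
    ext g'
    simp [hmemB]
  have hcover : (Set.univ : Set X) ≤ᵐ[μ] (S ∪ T g ⁻¹' E : Set X) := by
    filter_upwards [hcoc] with x hx _
    have hgood : {g' : G | (wlen SG (g' * g⁻¹) : ℝ) ≤ R ∧
        (wlen SH (α g' x * (α g x)⁻¹) : ℝ) ≤ 2 * M * R}.ncard =
        (B.filter fun k => ¬ 2 * M * R < (wlen SH (α k (T g x)) : ℝ)).card := by
      rw [← Set.ncard_coe_finset (B.filter _),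
        ← Set.ncard_image_of_injective ((B.filter _ : Finset G) : Set G) (mul_left_injective g)]
      congr 1
      ext g'
      simp only [Set.mem_ofPred_eq, Finset.coe_filter, Set.mem_image, ← eq_mul_inv_iff_mul_eq,
        exists_eq_right, hmemB, not_lt]
      refine and_congr_right fun hg' => ?_
      have := hx (g' * g⁻¹) ((hmemB _).2 hg')
      rw [inv_mul_cancel_right] at this
      rw [this, mul_inv_cancel_right]
    have hadd := B.card_filter_add_card_filter_not
      (fun k => 2 * M * R < (wlen SH (α k (T g x)) : ℝ))
    by_contra hcon
    obtain ⟨hS, hE'⟩ := not_or.1 hcon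
    rw [hSdef, Set.mem_ofPred_eq, not_le] at hS
    rw [hEdef, Set.mem_preimage, Set.mem_ofPred_eq, not_lt] at hE'
    rw [hball, hgood] at hS
    have hadd' := congrArg (Nat.cast (R := ℝ)) hadd
    push_cast at hadd'
    linarith
  have h1 : 1 ≤ μ S + ENNReal.ofReal δ := by
    rw [← measure_univ (μ := μ)]
    exact (measure_mono_ae hcover).trans ((measure_union_le _ _).trans (by gcongr))
  rw [ENNReal.ofReal_sub _ hδ.le, ENNReal.ofReal_one]
  exact tsub_le_iff_right.2 h1
end

section
/- Let (Ω,m) be a measure coupling of countable groups G and H, with finite-measure fundamental domains X ⊆ Ω for the H-action and Y ⊆ Ω for the G-action, associated cocycle α : G × X → H determined by g·x ∈ α(g,x)⁻¹·X, and induced m-preserving G-action on X given by T^g x := α(g,x)·(g·x). Assume the G × H-action on Ω is ergodic and the G-action on Ω is essentially free. Then α is a measurable embedding with constant ⌈m(X)/m(Y)⌉: there exists a measurable map φ : X → H such that the cohomologous cocycle α'(g,x) := φ(T^g x)·α(g,x)·φ(x)⁻¹ satisfies, for every h ∈ H and m-a.e. x ∈ X, |{g ∈ G : α'(g,x) = h}|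 ≤ ⌈m(X)/m(Y)⌉. -/
open MeasureTheory

section MeasureCoupling

variable {G Ω : Type*}

theorem coe_encard_return_eq_tsum (A : G → Ω → Ω) (Z : Set Ω) (ω : Ω) :
    (({g | A g ω ∈ Z}.encard : ENat) : ENNReal) = ∑' g, (A g ⁻¹' Z).indicator 1 ω := by
  rw [← ENNReal.tsum_set_one, tsum_subtype {g | A g ω ∈ Z} (fun _ => (1 : ENNReal))]
  rfl

theorem measurable_encard_return [MeasurableSpace Ω] [Countable G] {A : G → Ω → Ω}
    (hA : ∀ g, Measurable (A g))
    {Z : Set Ω} (hZ : MeasurableSet Z) :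
    Measurable fun ω => (({g | A g ω ∈ Z}.encard : ENat) : ENNReal) := by
  simp_rw [coe_encard_return_eq_tsum]
  exact Measurable.tsum fun g => measurable_one.indicator (hA g hZ)

theorem lintegral_encard_return_comm [MeasurableSpace Ω] [Group G] [Countable G]
    {m : Measure Ω} {A : G → Ω → Ω}
    (hA1 : ∀ ω, A 1 ω = ω) (hAmul : ∀ g g' ω, A (g * g') ω = A g (A g' ω))
    (hA : ∀ g, MeasurePreserving (A g) m m)
    {Y Z : Set Ω} (hY : MeasurableSet Y) (hZ : MeasurableSet Z) :
    ∫⁻ ω in Y, ({g | A g ω ∈ Z}.encard : ENNReal) ∂m =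
      ∫⁻ ω in Z, ({g | A g ω ∈ Y}.encard : ENNReal) ∂m := by
  have key : ∀ {Y Z : Set Ω}, MeasurableSet Y → MeasurableSet Z →
      ∫⁻ ω in Y, ({g | A g ω ∈ Z}.encard : ENNReal) ∂m = ∑' g, m (A g ⁻¹' Z ∩ Y) := by
    intro Y Z hY hZ
    simp_rw [coe_encard_return_eq_tsum]
    rw [lintegral_tsum fun g => (measurable_one.indicator ((hA g).measurable hZ)).aemeasurable]
    refine tsum_congr fun g => ?_
    rw [lintegral_indicator_one ((hA g).measurable hZ),
      Measure.restrict_apply ((hA g).measurable hZ)]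
  rw [key hY hZ, key hZ hY, ← (Equiv.inv G).tsum_eq]
  refine tsum_congr fun g => ?_
  rw [← (hA g).measure_preimage
    (((hA _).measurable hZ).inter hY).nullMeasurableSet]
  congr 1
  ext ω
  simp [← hAmul, hA1, and_comm]

theorem setLIntegral_encard_return_eq_measure [MeasurableSpace Ω] [Group G] [Countable G]
    {m : Measure Ω} {A : G → Ω → Ω}
    (hA1 : ∀ ω, A 1 ω = ω) (hAmul : ∀ g g' ω, A (g * g') ω = A g (A g' ω))
    (hA : ∀ g, MeasurePreserving (A g) m m)
    {Y Z : Set Ω} (hY : MeasurableSet Y) (hZ : MeasurableSet Z)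
    (hYfund : ∀ᵐ ω ∂m, ∃! g : G, A g ω ∈ Y) :
    ∫⁻ ω in Y, ({g | A g ω ∈ Z}.encard : ENNReal) ∂m = m Z := by
  rw [lintegral_encard_return_comm hA1 hAmul hA hY hZ, ← setLIntegral_one]
  refine lintegral_congr_ae (ae_restrict_of_ae ?_)
  filter_upwards [hYfund] with ω hω
  obtain ⟨g, hg, hu⟩ := hω
  have : {g | A g ω ∈ Y} = {g} := by
    ext g'
    exact ⟨fun h => hu g' h, fun h => by rw [Set.mem_singleton_iff.1 h]; exact hg⟩
  simp [this]

theorem measure_eq_zero_of_inter_fundamental [MeasurableSpace Ω] [Countable G]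
    {m : Measure Ω} {A : G → Ω → Ω}
    (hA : ∀ g, MeasurePreserving (A g) m m) {Y U : Set Ω}
    (hYfund : ∀ᵐ ω ∂m, ∃ g : G, A g ω ∈ Y)
    (hU : ∀ g ω, ω ∈ U → A g ω ∈ U) (h0 : m (Y ∩ U) = 0) : m U = 0 := by
  have h : ∀ᵐ ω ∂m, ∀ g, A g ω ∉ Y ∩ U := by
    rw [ae_all_iff]
    intro g
    exact (hA g).quasiMeasurePreserving.ae (measure_eq_zero_iff_ae_notMem.1 h0)
  rw [measure_eq_zero_iff_ae_notMem]
  filter_upwards [h, hYfund] with ω h1 ⟨g, hg⟩ hω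
  exact h1 g ⟨hg, hU g ω hω⟩

theorem measurableSet_existsUnique [MeasurableSpace Ω] [Countable G] {A : G → Ω → Ω}
    (hA : ∀ g, Measurable (A g))
    {Y : Set Ω} (hY : MeasurableSet Y) : MeasurableSet {ω | ∃! g : G, A g ω ∈ Y} := by
  have : {ω | ∃! g : G, A g ω ∈ Y} =
      ⋃ g, (A g ⁻¹' Y ∩ ⋂ g', ⋂ (_ : g' ≠ g), (A g' ⁻¹' Y)ᶜ) := by
    ext ω
    simp only [ExistsUnique, Set.mem_ofPred_eq, Set.mem_iUnion, Set.mem_inter_iff, Set.mem_preimage,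
      Set.mem_iInter, Set.mem_compl_iff]
    refine exists_congr fun g => and_congr_right fun _ => forall_congr' fun g' => ?_
    tauto
  rw [this]
  exact .iUnion fun g => (hA g hY).inter <| .iInter fun g' => .iInter fun _ => (hA g' hY).compl

/-- Pieces small enough to meet every orbit at most once, jointly covering almost everything. -/
theorem exists_injective_pieces [MeasurableSpace Ω] [Group G] [Countable G]
    {m : Measure Ω} {A : G → Ω → Ω}
    (hAmul : ∀ g g' ω, A (g * g') ω = A g (A g' ω)) (hA : ∀ g, Measurable (A g))
    {Y : Set Ω} (hY : MeasurableSet Y) (hYfund : ∀ᵐ ω ∂m, ∃! g : G, A g ω ∈ Y) :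
    ∃ D : G → Set Ω, (∀ g, MeasurableSet (D g)) ∧
      (∀ g ω, {g' | A g' ω ∈ D g}.Subsingleton) ∧ ∀ᵐ ω ∂m, ∃ g, ω ∈ D g := by
  refine ⟨fun g => A g ⁻¹' Y ∩ {ω | ∃! g : G, A g ω ∈ Y}, fun g => (hA g hY).inter
    (measurableSet_existsUnique hA hY), ?_, ?_⟩
  · rintro g ω a ⟨ha, -⟩ b ⟨hb, u⟩
    have e : A (g * a * b⁻¹) (A b ω) = A g (A a ω) := by
      rw [← hAmul, ← hAmul]; simp
    have := u.unique (e ▸ ha : A (g * a * b⁻¹) (A b ω) ∈ Y) hb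
    simpa [mul_assoc, mul_inv_eq_one] using this
  · filter_upwards [hYfund] with ω hω
    exact ⟨hω.choose, hω.choose_spec.1, hω⟩

end MeasureCoupling

section Greedy

variable {G H Ω : Type*}

/-- `Z` is measurable, meets each `H`-orbit at most once and each `G`-orbit at most `k` times. -/
structure IsPartialDomain [MeasurableSpace Ω] (A : G → Ω → Ω) (B : H → Ω → Ω)
    (k : ℕ) (Z : Set Ω) : Prop where
  measurableSet : MeasurableSet Z
  subsingleton : ∀ ω, {h | B h ω ∈ Z}.Subsingleton
  encard_le : ∀ ω, {g | A g ω ∈ Z}.encard ≤ k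

/-- The points whose `H`-orbit misses `Z` and whose `G`-orbit meets `Z` fewer than `k` times. -/
def roomFor (A : G → Ω → Ω) (B : H → Ω → Ω) (k : ℕ) (Z : Set Ω) : Set Ω :=
  {ω | (∀ h, B h ω ∉ Z) ∧ {g | A g ω ∈ Z}.encard < k}

theorem roomFor_anti (A : G → Ω → Ω) (B : H → Ω → Ω) (k : ℕ) {Z Z' : Set Ω} (h : Z ⊆ Z') :
    roomFor A B k Z' ⊆ roomFor A B k Z := fun _ hω =>
  ⟨fun b hb => hω.1 b (h hb), lt_of_le_of_lt (Set.encard_le_encard fun _ hg => h hg) hω.2⟩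

theorem encard_return_smul [Group G] {A : G → Ω → Ω} (hAmul : ∀ g g' ω, A (g * g') ω = A g (A g' ω))
    (Z : Set Ω) (a : G) (ω : Ω) : {g | A g (A a ω) ∈ Z}.encard = {g | A g ω ∈ Z}.encard := by
  have : {g | A g ω ∈ Z} = (Equiv.mulRight a) '' {g | A g (A a ω) ∈ Z} := by
    ext g
    simp [← hAmul]
  rw [this, (Equiv.mulRight a).injective.encard_image]

theorem measurableSet_missed [MeasurableSpace Ω] [Countable H] {B : H → Ω → Ω}
    (hB : ∀ h, Measurable (B h))
    {Z : Set Ω} (hZ : MeasurableSet Z) : MeasurableSet {ω | ∀ h, B h ω ∉ Z} := by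
  rw [Set.ofPred_forall]
  exact .iInter fun h => (hB h hZ).compl

theorem measurableSet_encard_lt [MeasurableSpace Ω] [Countable G] {A : G → Ω → Ω}
    (hA : ∀ g, Measurable (A g))
    {Z : Set Ω} (hZ : MeasurableSet Z) (k : ℕ) :
    MeasurableSet {ω | {g | A g ω ∈ Z}.encard < k} := by
  have := measurableSet_lt (measurable_encard_return hA hZ) (measurable_const (a := (k : ENNReal)))
  convert this using 3 with ω
  rw [← ENat.toENNReal_coe, ENat.toENNReal_lt]

variable {A : G → Ω → Ω} {B : H → Ω → Ω} {k : ℕ}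

theorem IsPartialDomain.union_inter_roomFor [MeasurableSpace Ω] [Group G] [Group H]
    [Countable G] [Countable H] {Z D : Set Ω} (hZ : IsPartialDomain A B k Z)
    (hAmul : ∀ g g' ω, A (g * g') ω = A g (A g' ω))
    (hBmul : ∀ h h' ω, B (h * h') ω = B h (B h' ω))
    (hA : ∀ g, Measurable (A g)) (hB : ∀ h, Measurable (B h))
    (hD : MeasurableSet D) (hDA : ∀ ω, {g | A g ω ∈ D}.Subsingleton)
    (hDB : ∀ ω, {h | B h ω ∈ D}.Subsingleton) :
    IsPartialDomain A B k (Z ∪ D ∩ roomFor A B k Z) where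
  measurableSet := hZ.measurableSet.union <| hD.inter <|
    (measurableSet_missed hB hZ.measurableSet).inter (measurableSet_encard_lt hA hZ.measurableSet k)
  subsingleton := by
    have key : ∀ ω a b, B a ω ∈ Z → B b ω ∈ roomFor A B k Z → False := by
      intro ω a b ha hb
      refine hb.1 (a * b⁻¹) ?_
      rw [← hBmul]
      simpa using ha
    rintro ω a (ha | ha) b (hb | hb)
    · exact hZ.subsingleton ω ha hb
    · exact (key ω a b ha hb.2).elim
    · exact (key ω b a hb ha.2).elim
    · exact hDB ω ha.1 hb.1
  encard_le := by
    intro ω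
    by_cases h : ∃ a, A a ω ∈ D ∩ roomFor A B k Z
    · obtain ⟨a, -, ha⟩ := h
      have hlt := ha.2
      rw [encard_return_smul hAmul] at hlt
      calc {g | A g ω ∈ Z ∪ D ∩ roomFor A B k Z}.encard
          ≤ ({g | A g ω ∈ Z} ∪ {g | A g ω ∈ D}).encard := by
            refine Set.encard_le_encard ?_
            rintro g (hg | hg)
            exacts [Or.inl hg, Or.inr hg.1]
        _ ≤ {g | A g ω ∈ Z}.encard + {g | A g ω ∈ D}.encard := Set.encard_union_le _ _
        _ ≤ {g | A g ω ∈ Z}.encard + 1 := by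
            gcongr
            exact Set.encard_le_one_iff_subsingleton.2 (hDA ω)
        _ ≤ k := Order.add_one_le_of_lt hlt
    · push Not at h
      refine le_trans (Set.encard_le_encard ?_) (hZ.encard_le ω)
      rintro g (hg | hg)
      exacts [hg, (h g hg).elim]

theorem IsPartialDomain.iUnion [MeasurableSpace Ω] {Z : ℕ → Set Ω} (hmono : Monotone Z)
    (hZ : ∀ n, IsPartialDomain A B k (Z n)) : IsPartialDomain A B k (⋃ n, Z n) where
  measurableSet := .iUnion fun n => (hZ n).measurableSet
  subsingleton := by
    intro ω a ha b hb
    obtain ⟨i, hi⟩ := Set.mem_iUnion.1 ha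
    obtain ⟨j, hj⟩ := Set.mem_iUnion.1 hb
    exact (hZ (max i j)).subsingleton ω (hmono (le_max_left i j) hi) (hmono (le_max_right i j) hj)
  encard_le := by
    intro ω
    by_contra! hlt
    obtain ⟨t, ht, htk⟩ := Set.exists_subset_encard_eq (Order.add_one_le_of_lt hlt)
    have htf : t.Finite := Set.finite_of_encard_eq_coe (k := k + 1) (by simpa using htk)
    have : ∀ g ∈ t, ∃ n, A g ω ∈ Z n := fun g hg => Set.mem_iUnion.1 (ht hg)
    choose! n hn using this
    obtain ⟨N, hN⟩ := (htf.image n).bddAbove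
    have hle : t ⊆ {g | A g ω ∈ Z N} := fun g hg =>
      hmono (hN (Set.mem_image_of_mem n hg)) (hn g hg)
    have := (Set.encard_le_encard hle).trans ((hZ N).encard_le ω)
    rw [htk] at this
    exact absurd this (by norm_cast; omega)

theorem exists_isPartialDomain_measure_roomFor_eq_zero [MeasurableSpace Ω]
    [Group G] [Group H] [Countable G] [Countable H] {m : Measure Ω}
    (hAmul : ∀ g g' ω, A (g * g') ω = A g (A g' ω))
    (hB1 : ∀ ω, B 1 ω = ω) (hBmul : ∀ h h' ω, B (h * h') ω = B h (B h' ω))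
    (hA : ∀ g, Measurable (A g)) (hB : ∀ h, Measurable (B h))
    {X Y : Set Ω} (hX : MeasurableSet X) (hY : MeasurableSet Y)
    (hXfund : ∀ᵐ ω ∂m, ∃! h : H, B h ω ∈ X) (hYfund : ∀ᵐ ω ∂m, ∃! g : G, A g ω ∈ Y) (k : ℕ) :
    ∃ Z, IsPartialDomain A B k Z ∧ m (roomFor A B k Z) = 0 := by
  obtain ⟨D, hD, hDinj, hDcov⟩ := exists_injective_pieces hAmul hA hY hYfund
  obtain ⟨E, hE, hEinj, hEcov⟩ := exists_injective_pieces hBmul hB hX hXfund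
  obtain ⟨e, he⟩ := exists_surjective_nat (G × H)
  let P : ℕ → Set Ω := fun n => D (e n).1 ∩ E (e n).2
  let Z : ℕ → Set Ω := fun n => Nat.rec ∅ (fun n Z => Z ∪ P n ∩ roomFor A B k Z) n
  have hZs : ∀ n, Z (n + 1) = Z n ∪ P n ∩ roomFor A B k (Z n) := fun _ => rfl
  have hmono : Monotone Z := monotone_nat_of_le_succ fun n => by
    rw [hZs]; exact Set.subset_union_left
  have hZ : ∀ n, IsPartialDomain A B k (Z n) := by
    intro n
    induction n with
    | zero => exact ⟨MeasurableSet.empty, fun ω a ha => ha.elim, fun ω => by simp [Z]⟩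
    | succ n ih =>
      rw [hZs]
      exact ih.union_inter_roomFor hAmul hBmul hA hB ((hD _).inter (hE _))
        (fun ω => (hDinj _ ω).anti fun _ h => h.1) (fun ω => (hEinj _ ω).anti fun _ h => h.2)
  refine ⟨⋃ n, Z n, .iUnion hmono hZ, ?_⟩
  rw [measure_eq_zero_iff_ae_notMem]
  filter_upwards [hDcov, hEcov] with ω ⟨g, hg⟩ ⟨h, hh⟩ hω
  obtain ⟨n, hn⟩ := he (g, h)
  have hmem : ω ∈ Z (n + 1) := by
    rw [hZs]
    refine Or.inr ⟨?_, roomFor_anti A B k (Set.subset_iUnion Z n) hω⟩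
    simp only [P, hn]
    exact ⟨hg, hh⟩
  refine hω.1 1 ?_
  rw [hB1]
  exact Set.mem_iUnion_of_mem (n + 1) hmem

end Greedy


theorem stmt15 {G H : Type*} [Group G] [Group H] [Countable G] [Countable H]
    -- the coupling space
    {Ω : Type*} [MeasurableSpace Ω] (m : Measure Ω) [SigmaFinite m] (hm : m ≠ 0)
    -- commuting measure-preserving actions of `G` and `H`
    (A : G → Ω → Ω) (B : H → Ω → Ω)
    (hA1 : ∀ ω, A 1 ω = ω) (hAmul : ∀ g g' ω, A (g * g') ω = A g (A g' ω))
    (hB1 : ∀ ω, B 1 ω = ω) (hBmul : ∀ h h' ω, B (h * h') ω = B h (B h' ω))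
    (hAmeas : ∀ g, Measurable (A g)) (hBmeas : ∀ h, Measurable (B h))
    (hApres : ∀ g, MeasurePreserving (A g) m m)
    (hBpres : ∀ h, MeasurePreserving (B h) m m)
    (hcomm : ∀ g h ω, A g (B h ω) = B h (A g ω))
    -- finite-measure fundamental domains: `Y` for the `G`-action, `X` for the `H`-action
    (X Y : Set Ω) (hXmeas : MeasurableSet X) (hYmeas : MeasurableSet Y)
    (hXfin : m X < ⊤) (hYfin : m Y < ⊤)
    (hXfund : ∀ᵐ ω ∂m, ∃! h : H, B h ω ∈ X)
    (hYfund : ∀ᵐ ω ∂m, ∃! g : G, A g ω ∈ Y)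
    -- the associated cocycle, determined by `g·x ∈ α(g,x)⁻¹·X`;
    -- the induced `G`-action on `X` is `T^g x = α(g,x)·(g·x) = B (α g x) (A g x)`
    (α : G → Ω → H) (hαmeas : ∀ (g : G) (h : H), MeasurableSet {ω | α g ω = h})
    (hαdef : ∀ g : G, ∀ᵐ ω ∂m, ω ∈ X → B (α g ω) (A g ω) ∈ X)
    -- the `G × H`-action on `Ω` is ergodic
    (hErg : ∀ E : Set Ω, MeasurableSet E →
      (∀ (g : G) (h : H), m (symmDiff ((fun ω => A g (B h ω)) ⁻¹' E) E) = 0) →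
      m E = 0 ∨ m Eᶜ = 0)
    -- the `G`-action on `Ω` is essentially free
    (hAfree : ∀ᵐ ω ∂m, ∀ g : G, A g ω = ω → g = 1) :
    ∃ φ : Ω → H, (∀ h : H, MeasurableSet {ω | φ ω = h}) ∧
      ∀ᵐ ω ∂m, ω ∈ X → ∀ h : H,
        {g : G | φ (B (α g ω) (A g ω)) * α g ω * (φ ω)⁻¹ = h}.Finite ∧
        ({g : G | φ (B (α g ω) (A g ω)) * α g ω * (φ ω)⁻¹ = h}).ncard ≤
          Nat.ceil ((m X).toReal / (m Y).toReal) := by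
  set k := Nat.ceil ((m X).toReal / (m Y).toReal) with hk
  obtain ⟨Z, hZ, hroom⟩ := exists_isPartialDomain_measure_roomFor_eq_zero (m := m) hAmul hB1 hBmul
    hAmeas hBmeas hXmeas hYmeas hXfund hYfund k
  have hZm := hZ.measurableSet
  set U : Set Ω := {ω | ∀ h, B h ω ∉ Z} with hU
  set V : Set Ω := {ω | {g | A g ω ∈ Z}.encard < k} with hV
  have hUm : MeasurableSet U := measurableSet_missed hBmeas hZm
  have hUB : ∀ h ω, ω ∈ U → B h ω ∈ U := fun h ω hω h' => by
    rw [← hBmul]; exact hω _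
  have hUB' : ∀ h ω, B h ω ∈ U ↔ ω ∈ U := fun h ω =>
    ⟨fun hω => by simpa [← hBmul, hB1] using hUB h⁻¹ _ hω, hUB h ω⟩
  have hYne : m Y ≠ 0 := by
    intro h0
    refine hm (Measure.measure_univ_eq_zero.1 ?_)
    exact measure_eq_zero_of_inter_fundamental hApres (hYfund.mono fun _ h => h.exists)
      (fun _ _ _ => trivial) (by simpa using h0)
  have hkY : m X ≤ k * m Y := by
    have h1 : (m X).toReal / (m Y).toReal ≤ k := Nat.le_ceil _
    rw [div_le_iff₀ (ENNReal.toReal_pos hYne hYfin.ne)] at h1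
    rw [← ENNReal.toReal_le_toReal hXfin.ne (ENNReal.mul_ne_top (by simp) hYfin.ne)]
    simpa using h1
  have hdich : m U = 0 ∨ m V = 0 := by
    have hEm : MeasurableSet (⋃ g, A g ⁻¹' U) := .iUnion fun g => hAmeas g hUm
    have hEinv : ∀ (g : G) (h : H),
        (fun ω => A g (B h ω)) ⁻¹' (⋃ g, A g ⁻¹' U) = ⋃ g, A g ⁻¹' U := by
      intro g h
      ext ω
      simp only [Set.mem_preimage, Set.mem_iUnion, hcomm, hUB']
      constructor
      · rintro ⟨a, ha⟩
        exact ⟨a * g, by rwa [hAmul]⟩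
      · rintro ⟨a, ha⟩
        exact ⟨a * g⁻¹, by rw [← hAmul]; simpa using ha⟩
    rcases hErg _ hEm fun g h => by rw [hEinv, symmDiff_self]; exact measure_empty with h0 | h0
    · left
      refine measure_mono_null (fun ω hω => Set.mem_iUnion.2 ⟨1, ?_⟩) h0
      rw [Set.mem_preimage, hA1]
      exact hω
    · right
      have hr : ∀ᵐ ω ∂m, ∀ g, A g ω ∉ roomFor A B k Z := ae_all_iff.2 fun g =>
        (hApres g).quasiMeasurePreserving.ae (measure_eq_zero_iff_ae_notMem.1 hroom)
      rw [measure_eq_zero_iff_ae_notMem]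
      filter_upwards [hr, measure_eq_zero_iff_ae_notMem.1 h0] with ω h1 h2 hω
      obtain ⟨g, hg⟩ := Set.mem_iUnion.1 (not_not.1 h2)
      exact h1 g ⟨hg, (encard_return_smul hAmul Z g ω).trans_lt hω⟩
  have hU0 : m U = 0 := by
    rcases hdich with h0 | h0
    · exact h0
    refine measure_eq_zero_of_inter_fundamental hBpres (hXfund.mono fun _ h => h.exists) hUB ?_
    have hZG : m Z = k * m Y := by
      rw [← setLIntegral_encard_return_eq_measure hA1 hAmul hApres hYmeas hZm hYfund,
        ← setLIntegral_const]
      refine lintegral_congr_ae (ae_restrict_of_ae ?_)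
      filter_upwards [measure_eq_zero_iff_ae_notMem.1 h0] with ω hω
      rw [le_antisymm (hZ.encard_le ω) (not_lt.1 hω), ENat.toENNReal_coe]
    have hZH : m Z ≤ m (X \ U) := by
      rw [← setLIntegral_encard_return_eq_measure hB1 hBmul hBpres hXmeas hZm hXfund]
      calc ∫⁻ ω in X, ({h | B h ω ∈ Z}.encard : ENNReal) ∂m
          ≤ ∫⁻ ω in X, Uᶜ.indicator 1 ω ∂m := by
            refine lintegral_mono fun ω => ?_
            by_cases hω : ω ∈ U
            · have : {h | B h ω ∈ Z} = ∅ := Set.eq_empty_of_forall_notMem hω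
              simp [this]
            · have := Set.encard_le_one_iff_subsingleton.2 (hZ.subsingleton ω)
              rw [Set.indicator_of_mem (show ω ∈ Uᶜ from hω), Pi.one_apply, ← ENat.toENNReal_one]
              exact ENat.toENNReal_le.2 this
        _ = m (X \ U) := by
            rw [lintegral_indicator_one hUm.compl, Measure.restrict_apply hUm.compl,
              Set.inter_comm, Set.sdiff_eq]
    have hle : m X ≤ m (X \ U) := hkY.trans (hZG ▸ hZH)
    have hsplit := measure_inter_add_sdiff (μ := m) X hUm
    have hfin : m (X \ U) ≠ ⊤ := ((measure_mono Set.sdiff_subset).trans_lt hXfin).ne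
    rw [← hsplit] at hle
    by_contra hne
    exact absurd hle (not_le.2 (by
      rw [add_comm]; exact ENNReal.lt_add_right hfin hne))
  classical
  let φ : Ω → H := fun ω => if hω : ∃ h, B h ω ∈ Z then hω.choose else 1
  have hφ : ∀ ω, ω ∉ U → B (φ ω) ω ∈ Z := by
    intro ω hω
    have hω' : ∃ h, B h ω ∈ Z := by simpa [hU] using hω
    simp only [φ, dif_pos hω']
    exact hω'.choose_spec
  refine ⟨φ, fun h => ?_, ?_⟩
  · have : {ω | φ ω = h} = B h ⁻¹' Z ∪ (U ∩ {_ω | h = 1}) := by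
      ext ω
      by_cases hω : ω ∈ U
      · have hn : ¬ ∃ h, B h ω ∈ Z := by simpa [hU] using hω
        simp [φ, hω, hn, hω h, eq_comm]
      · simp only [Set.mem_ofPred_eq, Set.mem_union, Set.mem_preimage, Set.mem_inter_iff, hω,
          false_and, or_false]
        exact ⟨fun e => e ▸ hφ ω hω, fun hh => hZ.subsingleton ω (hφ ω hω) hh⟩
    rw [this]
    exact (hBmeas h hZm).union (hUm.inter (.const _))
  · have hall : ∀ᵐ ω ∂m, ∀ g, A g ω ∉ U := ae_all_iff.2 fun g =>
      (hApres g).quasiMeasurePreserving.ae (measure_eq_zero_iff_ae_notMem.1 hU0)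
    filter_upwards [hall] with ω hω _ h
    have hsub : {g : G | φ (B (α g ω) (A g ω)) * α g ω * (φ ω)⁻¹ = h} ⊆
        {g | A g (B (h * φ ω) ω) ∈ Z} := by
      rintro g rfl
      have := hφ (B (α g ω) (A g ω)) (by rw [hUB']; exact hω g)
      rw [Set.mem_ofPred_eq, hcomm, inv_mul_cancel_right, hBmul]
      exact this
    have hle := (Set.encard_le_encard hsub).trans (hZ.encard_le _)
    have hfin := Set.finite_of_encard_le_coe hle
    refine ⟨hfin, ?_⟩
    rwa [← hfin.cast_ncard_eq, Nat.cast_le] at hle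
end

section
/- Let (Ω,m) be an integrable measure coupling of finitely generated groups G and H, with finite-measure fundamental domains X ⊆ Ω for the H-action and Y ⊆ Ω for the G-action, associated integrable cocycles α : G × X → H and β : H × Y → G, and induced m-preserving G-action T^g x := α(g,x)·(g·x) on X. Assume the G × H-action on Ω is ergodic and the G-action on Ω is essentially free. Then α is an integrable embedding: for every ε > 0 there exist a measurable map φ : X → H, a measurable set X₀ ⊆ X with m(X₀) > m(X) − ε, and a constant C > 0 such that the cohomologous cocycle α''(g,x) := φ(T^g x)·α(g,x)·φ(x)⁻¹ satisfies ∫_X |α''(g,x)|_H dm(x) < ∞ for every g ∈ G, and for m-a.e. x ∈ X₀ and every h ∈ H, |{g ∈ G : T^g x ∈ X₀ and α''(g,x) = h}| ≤ C. -/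
open MeasureTheory

theorem stmt16 {G H : Type*} [Group G] [Group H] [Countable G] [Countable H]
    (SG : Set G) (hSGfin : SG.Finite) (hSGsymm : ∀ s ∈ SG, s⁻¹ ∈ SG)
    (hSGgen : Subgroup.closure SG = ⊤)
    (SH : Set H) (hSHfin : SH.Finite) (hSHsymm : ∀ s ∈ SH, s⁻¹ ∈ SH)
    (hSHgen : Subgroup.closure SH = ⊤)
    -- the coupling space
    {Ω : Type*} [MeasurableSpace Ω] (m : Measure Ω) [SigmaFinite m] (hm : m ≠ 0)
    -- commuting measure-preserving actions of `G` and `H`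
    (A : G → Ω → Ω) (B : H → Ω → Ω)
    (hA1 : ∀ ω, A 1 ω = ω) (hAmul : ∀ g g' ω, A (g * g') ω = A g (A g' ω))
    (hB1 : ∀ ω, B 1 ω = ω) (hBmul : ∀ h h' ω, B (h * h') ω = B h (B h' ω))
    (hAmeas : ∀ g, Measurable (A g)) (hBmeas : ∀ h, Measurable (B h))
    (hApres : ∀ g, MeasurePreserving (A g) m m)
    (hBpres : ∀ h, MeasurePreserving (B h) m m)
    (hcomm : ∀ g h ω, A g (B h ω) = B h (A g ω))
    -- finite-measure fundamental domains: `Y` for the `G`-action, `X` for the `H`-action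
    (X Y : Set Ω) (hXmeas : MeasurableSet X) (hYmeas : MeasurableSet Y)
    (hXfin : m X < ⊤) (hYfin : m Y < ⊤)
    (hXfund : ∀ᵐ ω ∂m, ∃! h : H, B h ω ∈ X)
    (hYfund : ∀ᵐ ω ∂m, ∃! g : G, A g ω ∈ Y)
    -- the associated cocycles, determined by `g·x ∈ α(g,x)⁻¹·X` and `h·y ∈ β(h,y)⁻¹·Y`;
    -- the induced `G`-action on `X` is `T^g x = α(g,x)·(g·x) = B (α g x) (A g x)`
    (α : G → Ω → H) (hαmeas : ∀ (g : G) (h : H), MeasurableSet {ω | α g ω = h})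
    (hαdef : ∀ g : G, ∀ᵐ ω ∂m, ω ∈ X → B (α g ω) (A g ω) ∈ X)
    (β : H → Ω → G) (hβmeas : ∀ (h : H) (g : G), MeasurableSet {ω | β h ω = g})
    (hβdef : ∀ h : H, ∀ᵐ ω ∂m, ω ∈ Y → A (β h ω) (B h ω) ∈ Y)
    -- integrability of the coupling
    (hαint : ∀ g : G, IntegrableOn (fun ω => (wlen SH (α g ω) : ℝ)) X m)
    (hβint : ∀ h : H, IntegrableOn (fun ω => (wlen SG (β h ω) : ℝ)) Y m)
    -- the `G × H`-action on `Ω` is ergodic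
    (hErg : ∀ E : Set Ω, MeasurableSet E →
      (∀ (g : G) (h : H), m (symmDiff ((fun ω => A g (B h ω)) ⁻¹' E) E) = 0) →
      m E = 0 ∨ m Eᶜ = 0)
    -- the `G`-action on `Ω` is essentially free
    (hAfree : ∀ᵐ ω ∂m, ∀ g : G, A g ω = ω → g = 1) :
    ∀ ε : ℝ, 0 < ε → ∃ φ : Ω → H, (∀ h : H, MeasurableSet {ω | φ ω = h}) ∧
      ∃ X₀ : Set Ω, MeasurableSet X₀ ∧ X₀ ⊆ X ∧ (m X).toReal - ε < (m X₀).toReal ∧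
      ∃ C : ℕ, 0 < C ∧
        (∀ g : G, IntegrableOn
          (fun ω => (wlen SH (φ (B (α g ω) (A g ω)) * α g ω * (φ ω)⁻¹) : ℝ)) X m) ∧
        (∀ᵐ ω ∂m, ω ∈ X₀ → ∀ h : H,
          {g : G | B (α g ω) (A g ω) ∈ X₀ ∧
            φ (B (α g ω) (A g ω)) * α g ω * (φ ω)⁻¹ = h}.Finite ∧
          ({g : G | B (α g ω) (A g ω) ∈ X₀ ∧
            φ (B (α g ω) (A g ω)) * α g ω * (φ ω)⁻¹ = h}).ncard ≤ C) := by
  intro ε hε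
  let E : Finset G → Set Ω := fun F => X ∩ ⋃ f ∈ F, A f ⁻¹' Y
  have hEmeas : ∀ F, MeasurableSet (E F) := fun F =>
    hXmeas.inter (F.measurableSet_biUnion fun f _ => hAmeas f hYmeas)
  have hEmono : Monotone E := fun F F' hFF' =>
    Set.inter_subset_inter_right _ (Set.biUnion_subset_biUnion_left hFF')
  have hEunion : m (⋃ F, E F) = m X := by
    apply measure_congr
    filter_upwards [hYfund] with ω hω
    obtain ⟨g, hg, -⟩ := hω
    apply propext
    constructor
    · intro h
      obtain ⟨F, hF⟩ := Set.mem_iUnion.1 h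
      exact hF.1
    · intro h
      exact Set.mem_iUnion.2 ⟨{g}, h, by simpa using hg⟩
  have hEtendsto : Filter.Tendsto (fun F => (m (E F)).toReal) Filter.atTop
      (nhds (m X).toReal) := by
    have h := tendsto_measure_iUnion_atTop (μ := m) hEmono
    rw [hEunion] at h
    exact (ENNReal.tendsto_toReal hXfin.ne).comp h
  obtain ⟨F, hF⟩ := (hEtendsto.eventually_const_lt (sub_lt_self _ hε)).exists
  have hYtranslates : ∀ᵐ ω ∂m, ∀ h : H, ∃! g : G, A g (B h ω) ∈ Y :=
    ae_all_iff.2 fun h => (hBpres h).quasiMeasurePreserving.ae hYfund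
  refine ⟨fun _ => 1, fun h => MeasurableSet.const _, E F, hEmeas F, Set.inter_subset_left, hF,
    F.card + 1, Nat.succ_pos _, fun g => by simpa using hαint g, ?_⟩
  filter_upwards [hYtranslates] with ω hω _ h
  obtain ⟨u, -, hu⟩ := hω h
  classical
  have hsub : {g : G | B (α g ω) (A g ω) ∈ E F ∧ 1 * α g ω * (1 : H)⁻¹ = h} ⊆
      (F.image fun f => f⁻¹ * u : Finset G) := by
    rintro g ⟨⟨-, hg⟩, hgh⟩
    obtain ⟨f, hf, hfg⟩ := Set.mem_iUnion₂.1 hg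
    have hgh' : α g ω = h := by simpa using hgh
    rw [Set.mem_preimage, hgh', ← hcomm, ← hAmul] at hfg
    exact Finset.mem_coe.2 (Finset.mem_image.2 ⟨f, hf, by rw [← hu _ hfg]; group⟩)
  refine ⟨(Finset.finite_toSet _).subset hsub, ?_⟩
  calc _ ≤ (↑(F.image fun f => f⁻¹ * u) : Set G).ncard :=
        Set.ncard_le_ncard hsub (Finset.finite_toSet _)
    _ = (F.image fun f => f⁻¹ * u).card := Set.ncard_coe_finset _
    _ ≤ F.card := Finset.card_image_le
    _ ≤ F.card + 1 := Nat.le_succ _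
end
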